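/- arXiv:2101.05394 — 2 statements merged into one kernel-verified Lean document; each statement's English description precedes it below -/
import Mathlib

section
/- Let τ, α, ν > 0 and let n be a positive integer. Define h : ℝ → ℝ by h(θ) = (1/B(α,ν)) ∫₀¹ (1-δ cos θ)^{-τ} δ^{α-1} (1-δ)^{τ+ν-1} dδ (so that h(θ) = F_{τ,α,ν}(θ) for θ ∈ [0,π], extended evenly and 2π-periodically to ℝ). Then h is 2n times differentiable at θ = 0 (i.e., the 2n-th derivative h^{(2n)}(0) exists and is finite) if and only if ν > n. -/
open Real MeasureTheory

/-- Euler Beta function `B(a,b) = Γ(a)Γ(b)/Γ(a+b)`. -/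
noncomputable def betaFn (a b : ℝ) : ℝ := Real.Gamma a * Real.Gamma b / Real.Gamma (a + b)

/-- The even (and `2π`-periodic) extension to `ℝ` of the `F`-family correlation function:
`h(θ) = (1/B(α,ν)) ∫₀¹ (1-δ cos θ)^{-τ} δ^{α-1} (1-δ)^{τ+ν-1} dδ`. -/
noncomputable def FfamExt (τ α ν : ℝ) (θ : ℝ) : ℝ :=
  (1 / betaFn α ν) * ∫ δ in Set.Ioo (0:ℝ) 1,
    (1 - δ * Real.cos θ) ^ (-τ) * δ ^ (α - 1) * (1 - δ) ^ (τ + ν - 1)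


noncomputable def TT (j : ℕ) (s a b θ : ℝ) : ℝ :=
  ∫ δ in Set.Ioo (0:ℝ) 1,
    Real.sin θ ^ j * ((1 - δ * Real.cos θ) ^ (-s) * δ ^ (a - 1) * (1 - δ) ^ (b - 1))

lemma TT_eq (j : ℕ) (s a b θ : ℝ) : TT j s a b θ = Real.sin θ ^ j * TT 0 s a b θ := by
  simp only [TT, integral_const_mul]; simp

lemma u_ge (δ θ : ℝ) (h : δ ∈ Set.Ioo (0:ℝ) 1) : 1 - δ ≤ 1 - δ * Real.cos θ := by
  nlinarith [h.1, h.2, Real.cos_le_one θ]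

lemma u_pos (δ θ : ℝ) (h : δ ∈ Set.Ioo (0:ℝ) 1) : 0 < 1 - δ * Real.cos θ := by
  linarith [u_ge δ θ h, h.2]

lemma u_le (δ θ : ℝ) (h : δ ∈ Set.Ioo (0:ℝ) 1) : 1 - δ * Real.cos θ ≤ 2 := by
  nlinarith [h.1, h.2, Real.neg_one_le_cos θ]

lemma sin_sq_le (δ θ : ℝ) (h : δ ∈ Set.Ioo (0:ℝ) 1) :
    Real.sin θ ^ 2 ≤ 2 * (1 - δ * Real.cos θ) := by
  have := Real.sin_sq_add_cos_sq θ
  nlinarith [h.1, h.2, Real.neg_one_le_cos θ, Real.cos_le_one θ, sq_nonneg (Real.cos θ - 1),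
    sq_nonneg (Real.cos θ), mul_nonneg h.1.le (sq_nonneg (Real.cos θ - 1)), mul_nonneg (sub_nonneg.2 h.2.le) (sq_nonneg (Real.cos θ ))]

lemma key_bound (s r : ℝ) (j : ℕ) (hr : 0 ≤ r) (hs : s - j / 2 ≤ r) :
    ∃ C : ℝ, ∀ δ ∈ Set.Ioo (0:ℝ) 1, ∀ θ : ℝ,
      |Real.sin θ| ^ j * (1 - δ * Real.cos θ) ^ (-s) ≤ C * (1 - δ) ^ (-r) := by
  refine ⟨2 ^ ((j:ℝ)/2) * 2 ^ ((j:ℝ)/2 - s + r), fun δ h θ => ?_⟩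
  have hu := u_pos δ θ h
  set u := 1 - δ * Real.cos θ with hudef
  have h1 : |Real.sin θ| ^ j ≤ (2 * u) ^ ((j:ℝ)/2) := by
    have e : |Real.sin θ| ^ j = (Real.sin θ ^ 2) ^ ((j:ℝ)/2) := by
      rw [← sq_abs, ← Real.rpow_natCast (|Real.sin θ|) 2, ← Real.rpow_mul (abs_nonneg _),
        ← Real.rpow_natCast]
      congr 1
      push_cast; ring
    rw [e]
    exact Real.rpow_le_rpow (sq_nonneg _) (sin_sq_le δ θ h) (by positivity)
  have h1δ : 0 < 1 - δ := by linarith [h.2]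
  calc |Real.sin θ| ^ j * u ^ (-s) ≤ (2 * u) ^ ((j:ℝ)/2) * u ^ (-s) := by gcongr
    _ = 2 ^ ((j:ℝ)/2) * u ^ ((j:ℝ)/2 - s + r) * u ^ (-r) := by
      rw [Real.mul_rpow (by norm_num) hu.le, mul_assoc, mul_assoc, ← Real.rpow_add hu, ← Real.rpow_add hu]
      congr 2; ring
    _ ≤ 2 ^ ((j:ℝ)/2) * 2 ^ ((j:ℝ)/2 - s + r) * (1 - δ) ^ (-r) := by
      have h2 : u ^ ((j:ℝ)/2 - s + r) ≤ 2 ^ ((j:ℝ)/2 - s + r) :=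
        Real.rpow_le_rpow hu.le (u_le δ θ h) (by linarith)
      have h3 : u ^ (-r) ≤ (1 - δ) ^ (-r) :=
        Real.rpow_le_rpow_of_nonpos h1δ (u_ge δ θ h) (by linarith)
      gcongr

lemma beta_integrable (a c : ℝ) (ha : 0 < a) (hc : 0 < c) :
    IntegrableOn (fun δ : ℝ => δ ^ (a - 1) * (1 - δ) ^ (c - 1)) (Set.Ioo 0 1) := by
  have h := Complex.betaIntegral_convergent (u := a) (v := c) (by simpa) (by simpa)
  rw [intervalIntegrable_iff_integrableOn_Ioo_of_le (by simp)] at h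
  have h2 := h.re
  refine (integrable_congr ?_).1 h2
  filter_upwards [ae_restrict_mem measurableSet_Ioo] with x hx
  have e1 : ((x : ℂ) ^ ((a:ℂ) - 1)) = ((x ^ (a - 1) : ℝ) : ℂ) := by
    rw [Complex.ofReal_cpow hx.1.le]; simp
  have e2 : ((1 - x : ℂ) ^ ((c:ℂ) - 1)) = (((1 - x) ^ (c - 1) : ℝ) : ℂ) := by
    rw [Complex.ofReal_cpow (by linarith [hx.2])]; simp
  rw [e1, e2, ← Complex.ofReal_mul]; rfl

/-- pointwise domination -/
lemma TT_bound (s a b : ℝ) (j : ℕ) (r : ℝ) (hr : 0 ≤ r) (hs : s - j / 2 ≤ r) :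
    ∃ C : ℝ, ∀ δ ∈ Set.Ioo (0:ℝ) 1, ∀ θ : ℝ,
      ‖Real.sin θ ^ j * ((1 - δ * Real.cos θ) ^ (-s) * δ ^ (a - 1) * (1 - δ) ^ (b - 1))‖
        ≤ C * (δ ^ (a - 1) * (1 - δ) ^ (b - r - 1)) := by
  obtain ⟨C, hC⟩ := key_bound s r j hr hs
  refine ⟨C, fun δ h θ => ?_⟩
  have h1δ : 0 < 1 - δ := by linarith [h.2]
  have hu := u_pos δ θ h
  have hδ := h.1
  rw [norm_mul, norm_pow, Real.norm_eq_abs, Real.norm_of_nonneg (by positivity)]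
  calc _ = (|Real.sin θ| ^ j * (1 - δ * Real.cos θ) ^ (-s)) * (δ ^ (a - 1) * (1 - δ) ^ (b - 1)) := by ring
    _ ≤ (C * (1 - δ) ^ (-r)) * (δ ^ (a - 1) * (1 - δ) ^ (b - 1)) := by
      exact mul_le_mul_of_nonneg_right (hC δ h θ) (by positivity)
    _ = C * (δ ^ (a - 1) * ((1 - δ) ^ (-r) * (1 - δ) ^ (b - 1))) := by ring
    _ = _ := by rw [← Real.rpow_add h1δ]; congr 3; ring

lemma TT_meas (s a b : ℝ) (j : ℕ) (θ : ℝ) : AEStronglyMeasurable (fun δ : ℝ =>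
    Real.sin θ ^ j * ((1 - δ * Real.cos θ) ^ (-s) * δ ^ (a - 1) * (1 - δ) ^ (b - 1)))
    (volume.restrict (Set.Ioo 0 1)) := by
  apply Measurable.aestronglyMeasurable
  fun_prop

lemma TT_integrable (s a b : ℝ) (j : ℕ) (ha : 0 < a) (hb : 0 < b) (h : 2 * s - j < 2 * b) (θ : ℝ) :
    IntegrableOn (fun δ : ℝ =>
    Real.sin θ ^ j * ((1 - δ * Real.cos θ) ^ (-s) * δ ^ (a - 1) * (1 - δ) ^ (b - 1)))
    (Set.Ioo 0 1) := by
  obtain ⟨C, hC⟩ := TT_bound s a b j (max (s - j/2) 0) (le_max_right _ _) (le_max_left _ _)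
  refine Integrable.mono' ((beta_integrable a (b - max (s - j/2) 0) ha ?_).const_mul C)
    (TT_meas s a b j θ) ?_
  · have : max (s - j/2) 0 < b := max_lt (by linarith) hb
    linarith
  · filter_upwards [ae_restrict_mem measurableSet_Ioo] with x hx using hC x hx θ

lemma TT_continuous (s a b : ℝ) (j : ℕ) (ha : 0 < a) (hb : 0 < b) (h : 2 * s - j < 2 * b) :
    Continuous (TT j s a b) := by
  obtain ⟨C, hC⟩ := TT_bound s a b j (max (s - j/2) 0) (le_max_right _ _) (le_max_left _ _)
  unfold TT
  refine continuous_of_dominated (fun θ => TT_meas s a b j θ)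
    (bound := fun δ => C * (δ ^ (a - 1) * (1 - δ) ^ (b - max (s - j/2) 0 - 1))) ?_
    ((beta_integrable a (b - max (s - j/2) 0) ha ?_).const_mul C) ?_
  · intro θ
    filter_upwards [ae_restrict_mem measurableSet_Ioo] with x hx using hC x hx θ
  · have : max (s - j/2) 0 < b := max_lt (by linarith) hb
    linarith
  · filter_upwards [ae_restrict_mem measurableSet_Ioo] with x hx
    have : ∀ θ, 1 - x * Real.cos θ ≠ 0 := fun θ => (u_pos x θ hx).ne'
    have : Continuous fun θ => (1 - x * Real.cos θ) ^ (-s) :=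
      Continuous.rpow_const (by fun_prop) (fun θ => Or.inl (this θ))
    fun_prop

lemma TT_hasDerivAt (s a b : ℝ) (j : ℕ) (ha : 0 < a) (hb : 0 < b)
    (h : 2 * s + 1 - j < 2 * b) (θ : ℝ) :
    HasDerivAt (TT j s a b) (j * Real.cos θ * TT (j - 1) s a b θ
      - s * TT (j + 1) (s + 1) (a + 1) b θ) θ := by
  have hj1 : 2 * s - ((j - 1 : ℕ) : ℝ) < 2 * b := by
    rcases j with _ | j
    · simp at h ⊢; linarith
    · simp at h ⊢; linarith
  have hj2 : 2 * (s + 1) - ((j + 1 : ℕ) : ℝ) < 2 * b := by push_cast; linarith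
  set f1 : ℝ → ℝ → ℝ := fun θ δ => Real.sin θ ^ (j - 1) * ((1 - δ * Real.cos θ) ^ (-s) * δ ^ (a - 1) * (1 - δ) ^ (b - 1)) with hf1
  set f2 : ℝ → ℝ → ℝ := fun θ δ => Real.sin θ ^ (j + 1) * ((1 - δ * Real.cos θ) ^ (-(s + 1)) * δ ^ (a + 1 - 1) * (1 - δ) ^ (b - 1)) with hf2
  have i1 : ∀ θ, IntegrableOn (f1 θ) (Set.Ioo 0 1) := TT_integrable s a b (j-1) ha hb hj1
  have i2 : ∀ θ, IntegrableOn (f2 θ) (Set.Ioo 0 1) := TT_integrable (s+1) (a+1) b (j+1) (by linarith) hb hj2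
  obtain ⟨C1, hC1⟩ := TT_bound s a b (j-1) (max (s - (j-1:ℕ)/2) 0) (le_max_right _ _) (le_max_left _ _)
  obtain ⟨C2, hC2⟩ := TT_bound (s+1) (a+1) b (j+1) (max (s + 1 - (j+1:ℕ)/2) 0) (le_max_right _ _) (le_max_left _ _)
  have b1 := (beta_integrable a (b - max (s - (j-1:ℕ)/2) 0) ha (by
    have : max (s - (j-1:ℕ)/2) 0 < b := max_lt (by linarith) hb
    linarith)).const_mul C1
  have b2 := (beta_integrable (a+1) (b - max (s + 1 - (j+1:ℕ)/2) 0) (by linarith) (by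
    have : max (s + 1 - (j+1:ℕ)/2) 0 < b := max_lt (by linarith) hb
    linarith)).const_mul C2
  have e : j * Real.cos θ * TT (j - 1) s a b θ - s * TT (j + 1) (s + 1) (a + 1) b θ
      = ∫ δ in Set.Ioo (0:ℝ) 1, (j * Real.cos θ * f1 θ δ - s * f2 θ δ) := by
    rw [integral_sub ((i1 θ).const_mul _) ((i2 θ).const_mul _), integral_const_mul (↑j * Real.cos θ), integral_const_mul s]
    rfl
  rw [e]
  refine (hasDerivAt_integral_of_dominated_loc_of_deriv_le (s := Set.univ) Filter.univ_mem
    (Filter.Eventually.of_forall fun θ => TT_meas s a b j θ)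
    (TT_integrable s a b j ha hb (by linarith) θ)
    (F' := fun θ δ => j * Real.cos θ * f1 θ δ - s * f2 θ δ)
    (((i1 θ).const_mul _).sub ((i2 θ).const_mul _)).aestronglyMeasurable
    ?_ ((b1.const_mul j).add (b2.const_mul |s|)) ?_).2
  · filter_upwards [ae_restrict_mem measurableSet_Ioo] with x hx θ _
    refine (norm_sub_le _ _).trans ?_
    refine add_le_add ?_ ?_
    · rw [norm_mul, norm_mul, Real.norm_natCast]
      refine mul_le_mul ?_ (hC1 x hx θ) (norm_nonneg _) (by positivity)
      have := Real.abs_cos_le_one θ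
      exact mul_le_of_le_one_right (by positivity) this
    · rw [norm_mul]
      exact mul_le_mul_of_nonneg_left (hC2 x hx θ) (abs_nonneg _)
  · filter_upwards [ae_restrict_mem measurableSet_Ioo] with x hx θ _
    have hu := u_pos x θ hx
    have d1 : HasDerivAt (fun θ => Real.sin θ ^ j) (j * Real.sin θ ^ (j-1) * Real.cos θ) θ :=
      (Real.hasDerivAt_sin θ).pow j
    have d2 : HasDerivAt (fun θ => 1 - x * Real.cos θ) (x * Real.sin θ) θ := by
      have := ((Real.hasDerivAt_cos θ).const_mul x).const_sub 1
      exact this.congr_deriv (by ring)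
    have d3 := d2.rpow_const (p := -s) (Or.inl hu.ne')
    have d4 := d1.mul ((d3.mul_const (x ^ (a-1))).mul_const ((1 - x) ^ (b-1)))
    refine d4.congr_deriv ?_
    have ex : x ^ (a + 1 - 1) = x ^ (a - 1) * x := by
      rw [← Real.rpow_add_one hx.1.ne']; congr 1; ring
    simp only [hf1, hf2, ex, show -(s+1) = -s - 1 by ring]
    ring

lemma TT_contDiff (m : ℕ) : ∀ (s a b : ℝ) (j : ℕ), 0 < a → 0 < b → 2 * s + m - j < 2 * b →
    ContDiff ℝ m (TT j s a b) := by
  induction m with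
  | zero =>
    intro s a b j ha hb h
    simp only [Nat.cast_zero, contDiff_zero]
    exact TT_continuous s a b j ha hb (by simpa using h)
  | succ m ih =>
    intro s a b j ha hb h
    push_cast at h
    have hd := TT_hasDerivAt s a b j ha hb (by
      have : (0:ℝ) ≤ m := Nat.cast_nonneg m
      linarith)
    rw [show ((m + 1 : ℕ) : WithTop ℕ∞) = (m : WithTop ℕ∞) + 1 by push_cast; rfl]
    rw [contDiff_succ_iff_deriv]
    refine ⟨fun θ => (hd θ).differentiableAt, by simp, ?_⟩
    rw [show deriv (TT j s a b) = _ from funext fun θ => (hd θ).deriv]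
    have c2 := ih (s+1) (a+1) b (j+1) (by linarith) hb (by push_cast; linarith)
    rcases j with _ | j
    · simp only [Nat.cast_zero, zero_mul, zero_sub]
      exact (contDiff_const.mul c2).neg
    · have c1 := ih s a b j ha hb (by push_cast at h; linarith)
      exact ((contDiff_const.mul Real.contDiff_cos).mul c1).sub (contDiff_const.mul c2)

lemma TT_even (s a b θ : ℝ) : TT 0 s a b (-θ) = TT 0 s a b θ := by
  simp [TT]

lemma exists_large (s b : ℝ) : ∃ J : ℕ, 2 * s + 1 - J < 2 * b := by
  obtain ⟨J, hJ⟩ := exists_nat_gt (2 * s + 1 - 2 * b)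
  exact ⟨J, by linarith⟩

lemma TT0_hasDerivAt (s a b : ℝ) (ha : 0 < a) (hb : 0 < b) (θ : ℝ) (hθ : Real.sin θ ≠ 0) :
    HasDerivAt (TT 0 s a b) (-s * Real.sin θ * TT 0 (s + 1) (a + 1) b θ) θ := by
  obtain ⟨J, hJ⟩ := exists_large s b
  have h1 := TT_hasDerivAt s a b (J+1) ha hb (by push_cast; linarith) θ
  have h2 : HasDerivAt (fun θ => Real.sin θ ^ (J+1)) (((J+1 : ℕ):ℝ) * Real.sin θ ^ J * Real.cos θ) θ :=
    (Real.hasDerivAt_sin θ).pow (J+1)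
  have h3 := h1.div h2 (pow_ne_zero _ hθ)
  have ev : TT 0 s a b =ᶠ[nhds θ] (TT (J+1) s a b / fun θ => Real.sin θ ^ (J+1)) := by
    have : ∀ᶠ x in nhds θ, Real.sin x ≠ 0 := Real.continuous_sin.continuousAt.eventually_ne hθ
    filter_upwards [this] with x hx
    have : Real.sin x ^ (J+1) ≠ 0 := pow_ne_zero _ hx
    rw [Pi.div_apply, TT_eq (J+1)]
    field_simp
  refine (h3.congr_of_eventuallyEq ev).congr_deriv ?_
  rw [TT_eq (J+1+1), TT_eq (J+1), Nat.add_sub_cancel, TT_eq J]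
  field_simp
  ring

lemma TT0_integrable (s a b : ℝ) (ha : 0 < a) (hb : 0 < b) (θ : ℝ) (hθ : Real.sin θ ≠ 0) :
    IntegrableOn (fun δ : ℝ =>
      (1 - δ * Real.cos θ) ^ (-s) * δ ^ (a - 1) * (1 - δ) ^ (b - 1)) (Set.Ioo 0 1) := by
  obtain ⟨J, hJ⟩ := exists_large s b
  have := (TT_integrable s a b J ha hb (by linarith) θ).const_mul ((Real.sin θ ^ J)⁻¹)
  refine (integrable_congr (Filter.Eventually.of_forall fun δ => ?_)).1 this
  have : Real.sin θ ^ J ≠ 0 := pow_ne_zero _ hθ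
  field_simp

lemma not_integrable (s a b : ℝ) (h : b ≤ s) : ¬ IntegrableOn (fun δ : ℝ =>
      (1 - δ) ^ (-s) * δ ^ (a - 1) * (1 - δ) ^ (b - 1)) (Set.Ioo 0 1) := by
  intro hi
  have h1 : IntegrableOn (fun δ : ℝ =>
      (1 - δ) ^ (-s) * δ ^ (a - 1) * (1 - δ) ^ (b - 1)) (Set.Ioc (1/2) 1) := by
    rw [integrableOn_Ioc_iff_integrableOn_Ioo]
    exact hi.mono_set (Set.Ioo_subset_Ioo (by norm_num) le_rfl)
  have h1' := (intervalIntegrable_iff_integrableOn_Ioc_of_le (by norm_num)).2 h1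
  have hc : ContinuousOn (fun δ : ℝ => δ ^ (1 - a)) (Set.uIcc (1/2) 1) := by
    intro x hx
    rw [Set.uIcc_of_le (by norm_num)] at hx
    exact (Real.continuousAt_rpow_const x _ (Or.inl (by have := hx.1; linarith))).continuousWithinAt
  have h2 := h1'.continuousOn_mul hc
  have h3 := h2.comp_sub_left 1
  have h4 := h3.symm
  norm_num at h4
  rw [intervalIntegrable_iff_integrableOn_Ioo_of_le (by norm_num)] at h4
  have h5 : IntegrableOn (fun x : ℝ => x ^ (b - s - 1)) (Set.Ioo 0 (1/2)) := by
    refine (integrable_congr ?_).1 h4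
    filter_upwards [ae_restrict_mem measurableSet_Ioo] with x hx
    have hx1 : 0 < 1 - x := by linarith [hx.2]
    have e1 : (1 - x) ^ (1 - a) * (1 - x) ^ (a - 1) = 1 := by
      rw [← Real.rpow_add hx1]; simp
    have e2 : x ^ (-s) * x ^ (b - 1) = x ^ (b - s - 1) := by
      rw [← Real.rpow_add hx.1]; congr 1; ring
    calc _ = ((1 - x) ^ (1 - a) * (1 - x) ^ (a - 1)) * (x ^ (-s) * x ^ (b - 1)) := by ring
      _ = _ := by rw [e1, e2, one_mul]
  rw [intervalIntegral.integrableOn_Ioo_rpow_iff (by norm_num)] at h5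
  linarith

lemma blowup (s a b : ℝ) (ha : 0 < a) (hb : 0 < b) (f : ℝ → ℝ) (hf : ContinuousAt f 0)
    (he : ∀ᶠ θ in nhdsWithin 0 {0}ᶜ, Real.sin θ ≠ 0 ∧ f θ = TT 0 s a b θ) : s < b := by
  by_contra! hsb
  obtain ⟨x, hx⟩ := Filter.exists_seq_tendsto (nhdsWithin (0:ℝ) {0}ᶜ)
  have hx0 : Filter.Tendsto x Filter.atTop (nhds 0) := hx.mono_right nhdsWithin_le_nhds
  have hxe := hx.eventually he
  apply not_integrable s a b hsb
  refine integrable_of_tendsto (G := fun k δ => (1 - δ * Real.cos (x k)) ^ (-s) * δ ^ (a - 1) * (1 - δ) ^ (b - 1)) ?_ ?_ ?_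
  · filter_upwards [ae_restrict_mem measurableSet_Ioo] with δ hδ
    have hc : ContinuousAt (fun θ => (1 - δ * Real.cos θ) ^ (-s)) 0 :=
      ContinuousAt.rpow_const (by fun_prop) (Or.inl (u_pos δ 0 hδ).ne')
    have := hc.tendsto.comp hx0
    simp only [Real.cos_zero, mul_one] at this
    exact (this.mul_const _).mul_const _
  · intro k
    apply Measurable.aestronglyMeasurable
    fun_prop
  · have hl : Filter.Tendsto (fun n => ∫⁻ δ in Set.Ioo (0:ℝ) 1,
        ‖(1 - δ * Real.cos (x n)) ^ (-s) * δ ^ (a - 1) * (1 - δ) ^ (b - 1)‖ₑ) Filter.atTop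
        (nhds (ENNReal.ofReal (f 0))) := by
      have := (ENNReal.continuous_ofReal.tendsto _).comp (hf.tendsto.comp hx0)
      refine this.congr' ?_
      filter_upwards [hxe] with k hk
      simp only [Function.comp]
      rw [hk.2, TT]
      simp only [pow_zero, one_mul]
      rw [ofReal_integral_eq_lintegral_ofReal (TT0_integrable s a b ha hb _ hk.1)]
      · refine lintegral_congr_ae ?_
        filter_upwards [ae_restrict_mem measurableSet_Ioo] with δ hδ
        have := u_pos δ (x k) hδ
        have h0 := hδ.1
        have : 0 < 1 - δ := by linarith [hδ.2]
        rw [Real.enorm_of_nonneg (by positivity)]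
      · filter_upwards [ae_restrict_mem measurableSet_Ioo] with δ hδ
        have := u_pos δ (x k) hδ
        have h0 := hδ.1
        have : 0 < 1 - δ := by linarith [hδ.2]
        simp only [Pi.zero_apply]
        positivity
    rw [hl.liminf_eq]
    exact ENNReal.ofReal_ne_top

lemma param_contDiff (k : ℕ) : ∀ (p : ℕ) (g : ℝ → ℝ), ContDiff ℝ k g →
    ContDiff ℝ k (fun θ => ∫ t in (0:ℝ)..1, t ^ p * g (t * θ)) := by
  induction k with
  | zero =>
    intro p g hg
    simp only [Nat.cast_zero, contDiff_zero] at hg ⊢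
    exact intervalIntegral.continuous_parametric_intervalIntegral_of_continuous' (by fun_prop) _ _
  | succ k ih =>
    intro p g hg
    rw [show ((k + 1 : ℕ) : WithTop ℕ∞) = (k : WithTop ℕ∞) + 1 by push_cast; rfl] at hg ⊢
    rw [contDiff_succ_iff_deriv] at hg
    obtain ⟨hd, -, hg'⟩ := hg
    have hc := hd.continuous
    have hc' := hg'.continuous
    have key : ∀ θ, HasDerivAt (fun θ => ∫ t in (0:ℝ)..1, t ^ p * g (t * θ))
        (∫ t in (0:ℝ)..1, t ^ (p+1) * deriv g (t * θ)) θ := by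
      intro θ
      obtain ⟨C, hC⟩ := (isCompact_closedBall (0:ℝ) (|θ| + 1)).exists_bound_of_continuousOn
        hc'.continuousOn
      refine (intervalIntegral.hasDerivAt_integral_of_dominated_loc_of_deriv_le
        (F' := fun θ t => t ^ (p+1) * deriv g (t * θ)) (bound := fun _ => C)
        (Metric.ball_mem_nhds θ one_pos) ?_ ?_ ?_ ?_ ?_ ?_).2
      · refine Filter.Eventually.of_forall fun x => ?_
        exact Continuous.aestronglyMeasurable (by fun_prop)
      · exact Continuous.intervalIntegrable (by fun_prop) _ _
      · exact Continuous.aestronglyMeasurable (by fun_prop)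
      · refine Filter.Eventually.of_forall fun t ht x hx => ?_
        rw [Set.uIoc_of_le (by norm_num)] at ht
        have h1 : ‖t ^ (p+1)‖ ≤ 1 := by
          rw [norm_pow]
          exact pow_le_one₀ (norm_nonneg _) (by rw [Real.norm_of_nonneg ht.1.le]; exact ht.2)
        have hx' : |x| ≤ |θ| + 1 := by
          rw [Metric.mem_ball, Real.dist_eq] at hx
          have := abs_sub_abs_le_abs_sub x θ
          linarith
        have h2 := hC (t * x) (by
          rw [mem_closedBall_zero_iff, norm_mul, Real.norm_of_nonneg ht.1.le, Real.norm_eq_abs]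
          nlinarith [abs_nonneg x, ht.1, ht.2])
        rw [norm_mul]
        nlinarith [norm_nonneg (t ^ (p+1)), norm_nonneg (deriv g (t * x))]
      · simp
      · refine Filter.Eventually.of_forall fun t ht x hx => ?_
        have := ((hd (t * x)).hasDerivAt.comp x ((hasDerivAt_id x).const_mul t)).const_mul (t ^ p)
        refine this.congr_deriv ?_
        simp; ring
    rw [contDiff_succ_iff_deriv]
    refine ⟨fun θ => (key θ).differentiableAt, by simp, ?_⟩
    rw [show deriv (fun θ => ∫ t in (0:ℝ)..1, t ^ p * g (t * θ)) = _ from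
      funext fun θ => (key θ).deriv]
    exact ih (p+1) (deriv g) hg'

lemma hadamard_global (k : ℕ) (g : ℝ → ℝ) (hg : ContDiff ℝ (k + 1 : ℕ) g) (h0 : g 0 = 0) :
    ∃ q : ℝ → ℝ, ContDiff ℝ k q ∧ q 0 = deriv g 0 ∧ ∀ θ, g θ = θ * q θ := by
  rw [show ((k + 1 : ℕ) : WithTop ℕ∞) = (k : WithTop ℕ∞) + 1 by push_cast; rfl] at hg
  rw [contDiff_succ_iff_deriv] at hg
  obtain ⟨hd, -, hg'⟩ := hg
  refine ⟨_, param_contDiff k 0 (deriv g) hg', by simp, fun θ => ?_⟩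
  have hc' := hg'.continuous
  have := intervalIntegral.integral_eq_sub_of_hasDerivAt (a := 0) (b := 1)
    (f := fun t => g (t * θ)) (f' := fun t => deriv g (t * θ) * θ) (fun t _ => by
      have := (hd (t * θ)).hasDerivAt.comp t ((hasDerivAt_id t).mul_const θ)
      exact this.congr_deriv (by simp)) (Continuous.intervalIntegrable (by fun_prop) _ _)
  simp only [intervalIntegral.integral_mul_const, one_mul, zero_mul, h0, sub_zero] at this
  simp only [pow_zero, one_mul]
  rw [← this]; ring

lemma globalize (k : ℕ) (f : ℝ → ℝ) (hf : ContDiffAt ℝ k f 0) :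
    ∃ g : ℝ → ℝ, ContDiff ℝ k g ∧ g =ᶠ[nhds 0] f := by
  have h1 : ∀ᶠ x in nhds (0:ℝ), ContDiffAt ℝ k f x := hf.eventually (by simp)
  obtain ⟨ε, hε, hb⟩ := Metric.eventually_nhds_iff_ball.1 h1
  let φ : ContDiffBump (0:ℝ) := ⟨ε/4, ε/2, by linarith, by linarith⟩
  refine ⟨fun x => φ x * f x, ?_, ?_⟩
  · rw [contDiff_iff_contDiffAt]
    intro x
    by_cases hx : x ∈ Metric.ball (0:ℝ) ε
    · exact φ.contDiffAt.mul (hb x hx)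
    · have : x ∉ tsupport φ := by
        rw [φ.tsupport_eq]
        intro h
        apply hx
        exact Metric.closedBall_subset_ball (show ε/2 < ε by linarith) h
      have h2 := notMem_tsupport_iff_eventuallyEq.1 this
      refine (contDiffAt_const (c := (0:ℝ))).congr_of_eventuallyEq ?_
      filter_upwards [h2] with y hy
      simp [hy]
  · filter_upwards [φ.eventuallyEq_one] with x hx
    simp [hx]

lemma sin_ne_zero_ev : ∀ᶠ θ in nhdsWithin (0:ℝ) {0}ᶜ, Real.sin θ ≠ 0 := by
  have := (Real.hasDerivAt_sin 0).eventually_ne (c := 0) (by simp)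
  simpa using this

lemma main_ind (n : ℕ) : ∀ (s a b : ℝ), 0 < s → 0 < a → 0 < b → ∀ f : ℝ → ℝ,
    ContDiffAt ℝ (2 * n : ℕ) f 0 → (∀ᶠ θ in nhdsWithin 0 {0}ᶜ, f θ = TT 0 s a b θ) →
    s + n < b := by
  induction n with
  | zero =>
    intro s a b hs ha hb f hf he
    simpa using blowup s a b ha hb f hf.continuousAt (sin_ne_zero_ev.and he)
  | succ n ih =>
    intro s a b hs ha hb f hf he
    obtain ⟨F, hF, hFf⟩ := globalize _ f hf
    have heF : ∀ᶠ θ in nhdsWithin 0 {0}ᶜ, F θ = TT 0 s a b θ := by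
      filter_upwards [he, hFf.filter_mono nhdsWithin_le_nhds] with θ h1 h2
      rw [h2, h1]
    rw [show ((2 * (n + 1) : ℕ) : WithTop ℕ∞) = ((2 * n + 1 : ℕ) : WithTop ℕ∞) + 1 by
      push_cast; ring_nf] at hF
    rw [contDiff_succ_iff_deriv] at hF
    obtain ⟨hd, -, hF'⟩ := hF
    -- the derivative vanishes at zero by evenness
    have hev : (fun θ => F (-θ)) =ᶠ[nhds 0] F := by
      rw [eventually_nhdsWithin_iff] at heF
      have hneg : Filter.Tendsto (fun x : ℝ => -x) (nhds 0) (nhds 0) := by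
        simpa using (continuous_neg (G := ℝ)).tendsto 0
      filter_upwards [heF, hneg.eventually heF] with θ h1 h2
      by_cases h0 : θ = 0
      · simp [h0]
      · rw [h1 h0, h2 (by simpa using h0), TT_even]
    have hd0 : deriv F 0 = 0 := by
      have h1 := hev.deriv_eq
      rw [deriv_comp_neg, neg_zero] at h1
      linarith
    obtain ⟨q, hq, -, hqe⟩ := hadamard_global (2 * n) (deriv F) hF' hd0
    obtain ⟨S, hS, hS0, hSe⟩ := hadamard_global (2 * n) Real.sin Real.contDiff_sin (by simp)
    have hS0' : S 0 ≠ 0 := by rw [hS0]; simp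
    have := ih (s + 1) (a + 1) b (by linarith) (by linarith) hb (fun θ => (-s)⁻¹ * (q θ / S θ))
      (contDiffAt_const.mul (hq.contDiffAt.div hS.contDiffAt hS0')) ?_
    · push_cast; linarith
    · rw [eventually_nhdsWithin_iff] at heF
      have hF2 := heF.eventually_nhds
      have hSev : ∀ᶠ θ in nhds 0, S θ ≠ 0 := hS.continuous.continuousAt.eventually_ne hS0'
      filter_upwards [sin_ne_zero_ev, hF2.filter_mono nhdsWithin_le_nhds, self_mem_nhdsWithin,
        hSev.filter_mono nhdsWithin_le_nhds] with θ h1 h2 h3 h4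
      have h3' : θ ≠ 0 := h3
      have hloc : F =ᶠ[nhds θ] TT 0 s a b := by
        filter_upwards [h2, isOpen_ne.mem_nhds h3'] with y hy hy0 using hy hy0
      have hder : deriv F θ = -s * Real.sin θ * TT 0 (s + 1) (a + 1) b θ := by
        rw [hloc.deriv_eq, (TT0_hasDerivAt s a b ha hb θ h1).deriv]
      rw [hqe θ, hSe θ] at hder
      have : q θ = -s * S θ * TT 0 (s + 1) (a + 1) b θ := by
        apply mul_left_cancel₀ h3'
        rw [hder]; ring
      rw [this]
      field_simp

/-- The even extension of `F_{τ,α,ν}` is `2n` times differentiable at `θ = 0`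
if and only if `ν > n`. -/
theorem FfamExt_contDiffAt_iff (τ α ν : ℝ) (hτ : 0 < τ) (hα : 0 < α) (hν : 0 < ν)
    (n : ℕ) (hn : 0 < n) :
    ContDiffAt ℝ (2 * n) (FfamExt τ α ν) 0 ↔ (n : ℝ) < ν := by
  have hB : betaFn α ν ≠ 0 := by
    unfold betaFn
    have h1 := Real.Gamma_pos_of_pos hα
    have h2 := Real.Gamma_pos_of_pos hν
    have h3 := Real.Gamma_pos_of_pos (add_pos hα hν)
    positivity
  have hE : FfamExt τ α ν = fun θ => (1 / betaFn α ν) * TT 0 τ α (τ + ν) θ := by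
    funext θ
    simp [FfamExt, TT]
  have hcast : ((2 : WithTop ℕ∞) * (n : WithTop ℕ∞)) = ((2 * n : ℕ) : WithTop ℕ∞) := by
    push_cast; rfl
  rw [hcast, hE]
  constructor
  · intro h
    have h2 : ContDiffAt ℝ (2 * n : ℕ) (fun θ => betaFn α ν *
        ((1 / betaFn α ν) * TT 0 τ α (τ + ν) θ)) 0 := contDiffAt_const.mul h
    have := main_ind n τ α (τ + ν) hτ hα (by linarith) _ h2
      (Filter.Eventually.of_forall fun θ => by field_simp)
    linarith
  · intro h
    have := TT_contDiff (2 * n) τ α (τ + ν) 0 hα (by linarith) (by push_cast; linarith)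
    exact (contDiff_const.mul this).contDiffAt
end

section
/- Let α > 0 and let z be a real number with 0 < z < 1. Write g(z) = 1/2 + (1/2)(1-z)^{1/2} and p(z) = -(α+1/2)(1-z) + α(1-z)^{1/2} + 1/2. Then ₂F₁(α, α+1/2, 2α+3; z) = Σ_{n=0}^∞ (α)_n (α+1/2)_n / ((2α+3)_n · n!) · z^n = ((2α+2) g(z)^{-2α} / ((α+2)(α+3/2) z²)) · [ ((-2α-1 + (2α+5/2)z)(2α+1) p(z)) / ((α+1)(α+1/2)) + (2α+1)(1-z) z ]. -/
open Real

/-- Pochhammer symbol (rising factorial) `(x)_n = x(x+1)⋯(x+n-1)`. -/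
noncomputable def poch (x : ℝ) (n : ℕ) : ℝ := Polynomial.eval x (ascPochhammer ℝ n)

lemma poch_zero (x : ℝ) : poch x 0 = 1 := by simp [poch]

lemma poch_succ (x : ℝ) (n : ℕ) : poch x (n+1) = poch x n * (x + n) := by
  simp [poch, ascPochhammer_succ_eval]

lemma poch_pos {x : ℝ} (hx : 0 < x) (n : ℕ) : 0 < poch x n :=
  ascPochhammer_pos n x hx

noncomputable def cc (s : ℝ) (n : ℕ) : ℝ :=
  poch (s/2) n * poch (s/2 + 1/2) n / (poch (s+1) n * n.factorial)

lemma cc_zero (s : ℝ) : cc s 0 = 1 := by simp [cc, poch_zero]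

lemma cc_pos {s : ℝ} (hs : 0 < s) (n : ℕ) : 0 < cc s n := by
  have h1 := poch_pos (x := s/2) (by positivity) n
  have h2 := poch_pos (x := s/2+1/2) (by positivity) n
  have h3 := poch_pos (x := s+1) (by positivity) n
  unfold cc; positivity

lemma cc_succ {s : ℝ} (hs : 0 < s) (n : ℕ) :
    cc s (n+1) = cc s n * ((s + 2*n) * (s + 1 + 2*n) / (4 * (s+1+n) * (n+1))) := by
  have h3 := (poch_pos (x := s+1) (by positivity) n).ne'
  have h4 : (s + 1 + n) ≠ 0 := by positivity
  have h5 : (n.factorial : ℝ) ≠ 0 := by positivity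
  have h6 : (n + 1 : ℝ) ≠ 0 := by positivity
  simp only [cc, poch_succ, Nat.factorial_succ]
  push_cast
  field_simp
  ring

/-- companion coefficients -/
noncomputable def dd (s : ℝ) (n : ℕ) : ℝ := cc s n * ((s + 2*n) / s)

lemma dd_pos {s : ℝ} (hs : 0 < s) (n : ℕ) : 0 < dd s n := by
  have := cc_pos hs n
  unfold dd; positivity

lemma cc_le_dd {s : ℝ} (hs : 0 < s) (n : ℕ) : cc s n ≤ dd s n := by
  have := cc_pos hs n
  unfold dd
  refine le_mul_of_one_le_right this.le ?_
  rw [le_div_iff₀ hs]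
  have : (0:ℝ) ≤ n := by positivity
  linarith

lemma dd_succ {s : ℝ} (hs : 0 < s) (n : ℕ) :
    dd s (n+1) = dd s n * ((s + 1 + 2*n) * (s + 2 + 2*n) / (4 * (s+1+n) * (n+1))) := by
  simp only [dd, cc_succ hs]
  have h4 : (s + 1 + n) ≠ 0 := by positivity
  have h6 : (n + 1 : ℝ) ≠ 0 := by positivity
  push_cast
  field_simp
  ring

lemma tends_aux (a b : ℝ) : Filter.Tendsto (fun n : ℕ => a / ((n:ℝ) + b)) Filter.atTop (nhds 0) :=
  Filter.Tendsto.div_atTop tendsto_const_nhds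
    (Filter.tendsto_atTop_add_const_right _ _ tendsto_natCast_atTop_atTop)

lemma summable_dd {s : ℝ} (hs : 0 < s) {ρ : ℝ} (h0 : 0 < ρ) (h1 : ρ < 1) :
    Summable (fun n : ℕ => ((n:ℝ)+1) * dd s n * ρ ^ n) := by
  refine summable_of_ratio_test_tendsto_lt_one h1 ?_ ?_
  · refine Filter.Eventually.of_forall fun n => ?_
    have := dd_pos hs n
    positivity
  · have hl : Filter.Tendsto (fun n : ℕ => (1 + 1 / ((n:ℝ) + 1)) * (1 + ((s-1)/2) / ((n:ℝ)+1))
        * (1 + (-s/2) / ((n:ℝ) + (s+1))) * ρ) Filter.atTop (nhds ((1+0)*(1+0)*(1+0)*ρ)) :=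
      ((((tends_aux _ _).const_add 1).mul ((tends_aux _ _).const_add 1)).mul
        ((tends_aux _ _).const_add 1)).mul_const ρ
    have e : (1+0)*(1+0)*(1+0)*ρ = ρ := by ring
    rw [e] at hl
    refine hl.congr fun n => ?_
    have hd := dd_pos hs n
    have hd1 := dd_pos hs (n+1)
    rw [Real.norm_of_nonneg (by positivity), Real.norm_of_nonneg (by positivity), dd_succ hs]
    have h4 : (s + 1 + n) ≠ 0 := by positivity
    have h4' : (n + (s + 1)) ≠ 0 := by positivity
    have h6 : (n + 1 : ℝ) ≠ 0 := by positivity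
    have h7 := hd.ne'
    push_cast
    field_simp
    ring

/-- differentiation of a dominated power series -/
lemma pow_deriv {s : ℝ} (hs : 0 < s) (a : ℕ → ℝ) (ha : ∀ n, |a n| ≤ dd s n) {x : ℝ}
    (h0 : 0 ≤ x) (h1 : x < 1) :
    Summable (fun n => a n * x ^ n) ∧ Summable (fun n : ℕ => n * a n * x ^ n) ∧
    ∃ D, HasDerivAt (fun y => ∑' n, a n * y ^ n) D x ∧ x * D = ∑' n : ℕ, n * a n * x ^ n := by
  obtain ⟨ρ, hxρ, hρ1⟩ := exists_between h1
  have hρ0 : 0 < ρ := lt_of_le_of_lt h0 hxρ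
  have S := summable_dd hs hρ0 hρ1
  have hxp : ∀ n, |x| ^ n ≤ ρ ^ n := fun n => by
    rw [abs_of_nonneg h0]; exact pow_le_pow_left₀ h0 hxρ.le n
  have s0 : Summable (fun n => a n * x ^ n) := by
    refine Summable.of_norm_bounded S fun n => ?_
    have hd := dd_pos hs n
    rw [norm_mul, norm_pow, Real.norm_eq_abs, Real.norm_eq_abs]
    refine mul_le_mul ((ha n).trans ?_) (hxp n) (by positivity) (by positivity)
    nlinarith [(Nat.cast_nonneg n : (0:ℝ) ≤ n)]
  have s1 : Summable (fun n : ℕ => n * a n * x ^ n) := by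
    refine Summable.of_norm_bounded S fun n => ?_
    have hd := dd_pos hs n
    rw [norm_mul, norm_mul, norm_pow, Real.norm_eq_abs, Real.norm_eq_abs, Real.norm_eq_abs,
      Nat.abs_cast]
    refine mul_le_mul (mul_le_mul (by linarith) (ha n) (by positivity) (by positivity)) (hxp n)
      (by positivity) (by positivity)
  refine ⟨s0, s1, ∑' n : ℕ, a n * (n * x ^ (n-1)), ?_, ?_⟩
  · have hmem : x ∈ Set.Ioo (-ρ) ρ := ⟨by linarith, hxρ⟩
    refine hasDerivAt_tsum_of_isPreconnected (u := fun n : ℕ => (((n:ℝ)+1) * dd s n * ρ ^ n) / ρ)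
      (g := fun n y => a n * y ^ n) (g' := fun n y => a n * (n * y ^ (n-1)))
      (t := Set.Ioo (-ρ) ρ) (y₀ := x) (y := x) (S.div_const ρ)
      isOpen_Ioo isPreconnected_Ioo ?_ ?_ hmem s0 hmem
    · intro n y hy
      exact (hasDerivAt_pow n y).const_mul (a n)
    · intro n y hy
      have hd := dd_pos hs n
      have hyρ : |y| ≤ ρ := abs_le.2 ⟨hy.1.le, hy.2.le⟩
      rcases n with _ | n
      · simp only [Nat.cast_zero, zero_mul, mul_zero, norm_zero]; positivity
      · rw [norm_mul, norm_mul, norm_pow, Real.norm_eq_abs, Real.norm_eq_abs, Real.norm_eq_abs,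
          Nat.abs_cast, pow_succ, Nat.add_sub_cancel, ← mul_assoc, ← mul_assoc, mul_div_cancel_right₀ _ hρ0.ne',
          mul_comm (|a (n+1)|)]
        refine mul_le_mul (mul_le_mul (by linarith) (ha _) (by positivity) (by positivity))
          (pow_le_pow_left₀ (abs_nonneg _) hyρ n) (by positivity) (by positivity)
  · rw [← tsum_mul_left]
    refine tsum_congr fun n => ?_
    rcases n with _ | n
    · simp
    · rw [Nat.add_sub_cancel, pow_succ]; ring

lemma const_aux {f : ℝ → ℝ} {z : ℝ} (hz : 0 < z) (hc : ContinuousOn f (Set.Icc 0 z))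
    (hd : ∀ x ∈ Set.Ioo 0 z, HasDerivAt f 0 x) : f z = f 0 := by
  obtain ⟨c, _, h⟩ := exists_hasDerivAt_eq_slope f (fun _ => 0) hz hc hd
  have : z - 0 ≠ 0 := by simpa using hz.ne'
  field_simp at h
  linarith

noncomputable def YY (s x : ℝ) : ℝ := ∑' n, cc s n * x ^ n
noncomputable def KK (s x : ℝ) : ℝ := ∑' n, dd s n * x ^ n

lemma Y_deriv {s : ℝ} (hs : 0 < s) {x : ℝ} (h0 : 0 ≤ x) (h1 : x < 1) :
    ∃ D, HasDerivAt (YY s) D x ∧ 2 * (x * D) = s * (KK s x - YY s x) := by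
  obtain ⟨sc, sc1, D, hD, hD'⟩ := pow_deriv hs (cc s)
    (fun n => by rw [abs_of_pos (cc_pos hs n)]; exact cc_le_dd hs n) h0 h1
  obtain ⟨sd, -, -⟩ := pow_deriv hs (dd s)
    (fun n => by rw [abs_of_pos (dd_pos hs n)]) h0 h1
  refine ⟨D, hD, ?_⟩
  rw [hD', KK, YY, ← sd.tsum_sub sc, ← tsum_mul_left, ← tsum_mul_left]
  refine tsum_congr fun n => ?_
  unfold dd
  field_simp
  ring

lemma K_deriv {s : ℝ} (hs : 0 < s) {x : ℝ} (h0 : 0 ≤ x) (h1 : x < 1) :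
    ∃ D, HasDerivAt (KK s) D x ∧
      2 * (1 - x) * (x * D) = s * (YY s x - (1 - x) * KK s x) + x * KK s x := by
  obtain ⟨sc, sc1, -⟩ := pow_deriv hs (cc s)
    (fun n => by rw [abs_of_pos (cc_pos hs n)]; exact cc_le_dd hs n) h0 h1
  obtain ⟨sd, sd1, D, hD, hD'⟩ := pow_deriv hs (dd s)
    (fun n => by rw [abs_of_pos (dd_pos hs n)]) h0 h1
  refine ⟨D, hD, ?_⟩
  have H1 : HasSum (fun n : ℕ => 2 * (n * dd s n * x ^ n) + s * (dd s n * x ^ n)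
      - s * (cc s n * x ^ n)) (2 * (x * D) + s * KK s x - s * YY s x) := by
    rw [hD']
    exact ((sd1.hasSum.mul_left 2).add (sd.hasSum.mul_left s)).sub (sc.hasSum.mul_left s)
  have H2 : HasSum (fun n : ℕ => x * (2 * (n * dd s n * x ^ n) + (s + 1) * (dd s n * x ^ n)))
      (x * (2 * (x * D) + (s + 1) * KK s x)) := by
    rw [hD']
    exact ((sd1.hasSum.mul_left 2).add (sd.hasSum.mul_left (s+1))).mul_left x
  have H3 := (hasSum_nat_add_iff' 1).2 H1
  have e : (fun n : ℕ => x * (2 * (n * dd s n * x ^ n) + (s + 1) * (dd s n * x ^ n))) =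
      fun n : ℕ => 2 * (((n+1:ℕ):ℝ) * dd s (n+1) * x ^ (n+1)) + s * (dd s (n+1) * x ^ (n+1))
      - s * (cc s (n+1) * x ^ (n+1)) := by
    funext n
    simp only [dd, cc_succ hs]
    have h4 : (s + 1 + n) ≠ 0 := by positivity
    have h6 : (n + 1 : ℝ) ≠ 0 := by positivity
    push_cast
    field_simp
    ring
  rw [e] at H2
  have := H2.unique H3
  simp [dd, cc_zero, hs.ne'] at this
  linarith

lemma Y_zero (s : ℝ) : YY s 0 = 1 := by
  rw [YY, tsum_eq_single 0]
  · simp [cc_zero]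
  · intro n hn; simp [hn]

lemma sqrt_facts {x : ℝ} (h0 : 0 < x) (h1 : x < 1) :
    0 < √(1-x) ∧ √(1-x) < 1 ∧ √(1-x) ^ 2 = 1 - x := by
  refine ⟨Real.sqrt_pos.2 (by linarith), ?_, Real.sq_sqrt (by linarith)⟩
  rw [Real.sqrt_lt' one_pos]; linarith

lemma sqrt_deriv {x : ℝ} (h1 : x < 1) :
    HasDerivAt (fun y : ℝ => √(1-y)) (-1 / (2 * √(1-x))) x := by
  have := ((hasDerivAt_id x).const_sub 1).sqrt (by simp only [id]; linarith)
  simpa using this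

lemma Y_eq_rK {s : ℝ} (hs : 0 < s) {z : ℝ} (h0 : 0 < z) (h1 : z < 1) :
    YY s z = √(1-z) * KK s z := by
  have key := const_aux (f := fun x => (YY s x - √(1-x) * KK s x) * (1/2 - 1/2 * √(1-x)) ^ s) h0
    ?_ ?_
  · simp only [sub_zero, Real.sqrt_one, mul_one, sub_self, Real.zero_rpow hs.ne', mul_zero] at key
    obtain ⟨_, hr, _⟩ := sqrt_facts h0 h1
    have hp : (0:ℝ) < (1/2 - 1/2 * √(1-z)) ^ s := Real.rpow_pos_of_pos (by linarith) s
    rcases mul_eq_zero.1 key with h | h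
    · linarith
    · exact absurd h hp.ne'
  · intro x hx
    have hx1 : x < 1 := lt_of_le_of_lt hx.2 h1
    obtain ⟨D, hD, -⟩ := Y_deriv hs hx.1 hx1
    obtain ⟨D', hD', -⟩ := K_deriv hs hx.1 hx1
    have hr := (sqrt_deriv hx1).continuousAt
    refine ContinuousAt.continuousWithinAt ?_
    refine (hD.continuousAt.sub (hr.mul hD'.continuousAt)).mul ?_
    exact (continuousAt_const.sub (continuousAt_const.mul hr)).rpow_const (Or.inr hs.le)
  · intro x hx
    have hx1 : x < 1 := hx.2.trans h1
    obtain ⟨D, hD, e⟩ := Y_deriv hs hx.1.le hx1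
    obtain ⟨D', hD', e'⟩ := K_deriv hs hx.1.le hx1
    have hr := sqrt_deriv hx1
    obtain ⟨r0, r1, r2⟩ := sqrt_facts hx.1 hx1
    have hg : (0:ℝ) < 1/2 - 1/2 * √(1-x) := by linarith
    have := (hD.sub (hr.mul hD')).mul
      (((hr.const_mul (1/2)).const_sub (1/2)).rpow_const (p := s) (Or.inl hg.ne'))
    refine this.congr_deriv ?_
    simp only [Pi.sub_apply, Pi.mul_apply]
    rw [Real.rpow_sub_one hg.ne']
    generalize (1/2 - 1/2 * √(1-x)) ^ s = P
    generalize √(1-x) = r at *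
    generalize YY s x = Y at *
    generalize KK s x = K at *
    have hx' : x = 1 - r^2 := by linarith
    have hx0 := hx.1
    subst hx'
    have q0 : (1 - r^2) ≠ 0 := hx0.ne'
    have eD : D = s * (K - Y) / (2 * (1 - r^2)) := by
      field_simp; linarith
    have eD' : D' = (s * (Y - r^2 * K) + (1 - r^2) * K) / (2 * r^2 * (1 - r^2)) := by
      field_simp
      have : (1 - (1 - r^2)) = r^2 := by ring
      rw [this] at e'
      linarith
    rw [eD, eD']
    have hf : (1 - r^2) = (1 - r) * (1 + r) := by ring
    have q1 : 1 - r ≠ 0 := by linarith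
    have q2 : 1 + r ≠ 0 := by linarith
    have q3 : (1/2 - 1/2 * r) = (1 - r)/2 := by ring
    rw [q3, hf]
    field_simp
    ring

lemma Y_closed {s : ℝ} (hs : 0 < s) {z : ℝ} (h0 : 0 < z) (h1 : z < 1) :
    YY s z = (1/2 + 1/2 * √(1-z)) ^ (-s) := by
  have key := const_aux (f := fun x => YY s x * (1/2 + 1/2 * √(1-x)) ^ s) h0
    ?_ ?_
  · have e1 : (1/2 + 1/2 : ℝ) = 1 := by norm_num
    simp only [sub_zero, Real.sqrt_one, mul_one, Y_zero, e1, Real.one_rpow] at key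
    have hg : (0:ℝ) < 1/2 + 1/2 * √(1-z) := by positivity
    rw [Real.rpow_neg hg.le]
    exact eq_inv_of_mul_eq_one_left key
  · intro x hx
    have hx1 : x < 1 := lt_of_le_of_lt hx.2 h1
    obtain ⟨D, hD, -⟩ := Y_deriv hs hx.1 hx1
    have hr := (sqrt_deriv hx1).continuousAt
    refine ContinuousAt.continuousWithinAt ?_
    refine hD.continuousAt.mul ?_
    exact (continuousAt_const.add (continuousAt_const.mul hr)).rpow_const (Or.inr hs.le)
  · intro x hx
    have hx1 : x < 1 := hx.2.trans h1
    obtain ⟨D, hD, e⟩ := Y_deriv hs hx.1.le hx1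
    have e' := Y_eq_rK hs hx.1 hx1
    have hr := sqrt_deriv hx1
    obtain ⟨r0, r1, r2⟩ := sqrt_facts hx.1 hx1
    have hg : (0:ℝ) < 1/2 + 1/2 * √(1-x) := by linarith
    have := hD.mul
      (((hr.const_mul (1/2)).const_add (1/2)).rpow_const (p := s) (Or.inl hg.ne'))
    refine this.congr_deriv ?_
    rw [Real.rpow_sub_one hg.ne']
    generalize (1/2 + 1/2 * √(1-x)) ^ s = P
    generalize √(1-x) = r at *
    generalize YY s x = Y at *
    generalize KK s x = K at *
    have hx' : x = 1 - r^2 := by linarith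
    have hx0 := hx.1
    subst hx'
    have q0 : (1 - r^2) ≠ 0 := hx0.ne'
    have eD : D = s * (K - Y) / (2 * (1 - r^2)) := by
      field_simp; linarith
    rw [eD, e']
    have hf : (1 - r^2) = (1 - r) * (1 + r) := by ring
    have q1 : 1 - r ≠ 0 := by linarith
    have q2 : 1 + r ≠ 0 := by linarith
    have q3 : (1/2 + 1/2 * r) = (1 + r)/2 := by ring
    rw [q3, hf]
    field_simp
    ring

lemma Y_hasSum {s : ℝ} (hs : 0 < s) {z : ℝ} (h0 : 0 < z) (h1 : z < 1) :
    HasSum (fun n => cc s n * z ^ n) ((1/2 + 1/2 * √(1-z)) ^ (-s)) := by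
  rw [← Y_closed hs h0 h1]
  exact (pow_deriv hs (cc s)
    (fun n => by rw [abs_of_pos (cc_pos hs n)]; exact cc_le_dd hs n) h0.le h1).1.hasSum

lemma cc_shift {s : ℝ} (hs : 0 < s) (n : ℕ) :
    cc (s+1) n = cc s n * ((s+1) * (s+2*n) / (s * (s+n+1))) := by
  induction n with
  | zero => simp [cc_zero]; field_simp
  | succ n ih =>
    rw [cc_succ (by linarith), cc_succ hs, ih]
    have h4 : (s + 1 + n) ≠ 0 := by positivity
    have h4' : (s + n + 1) ≠ 0 := by positivity
    have h5 : (s + 1 + 1 + n) ≠ 0 := by positivity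
    have h5' : (s + (n + 1) + 1) ≠ 0 := by positivity
    have h6 : (n + 1 : ℝ) ≠ 0 := by positivity
    push_cast
    field_simp
    ring

lemma poch_shift {x : ℝ} (hx : 0 < x) (n : ℕ) :
    poch (x+1) n = poch x n * ((x+n)/x) := by
  induction n with
  | zero => simp [poch_zero]; field_simp
  | succ n ih =>
    rw [poch_succ, poch_succ, ih]
    push_cast
    field_simp
    ring

/-- Closed form for `₂F₁(α, α+1/2, 2α+3; z)` on `0 < z < 1`:
with `g(z) = 1/2 + (1/2)√(1-z)` and `p(z) = -(α+1/2)(1-z) + α√(1-z) + 1/2`,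
`₂F₁(α, α+1/2, 2α+3; z) = ((2α+2) g(z)^{-2α} / ((α+2)(α+3/2) z²)) ·
  ( ((-2α-1 + (2α+5/2)z)(2α+1) p(z)) / ((α+1)(α+1/2)) + (2α+1)(1-z)z )`. -/
theorem hypergeom_closed_form_twice_diff (α z : ℝ) (hα : 0 < α) (hz0 : 0 < z) (hz1 : z < 1) :
    HasSum
      (fun n : ℕ =>
        poch α n * poch (α + 1/2) n / (poch (2*α + 3) n * n.factorial) * z ^ n)
      ((2*α + 2) * (1/2 + (1/2) * Real.sqrt (1 - z)) ^ (-(2*α)) /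
          ((α + 2) * (α + 3/2) * z ^ 2) *
        (((-2*α - 1 + (2*α + 5/2) * z) * (2*α + 1) *
            (-(α + 1/2) * (1 - z) + α * Real.sqrt (1 - z) + 1/2)) /
            ((α + 1) * (α + 1/2)) +
          (2*α + 1) * (1 - z) * z)) := by
  have hs : 0 < 2 * α := by positivity
  have H0 := Y_hasSum hs hz0 hz1
  have H1 := Y_hasSum (s := 2*α+1) (by positivity) hz0 hz1
  have H2 := Y_hasSum (s := 2*α+1+1) (by positivity) hz0 hz1
  have H := (((H0.mul_left (4*(α+3/2)*(α+1/2))).add (H1.mul_left (-(α*(4*α+5))))).add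
    (H2.mul_left (α*(α+1/2)))).div_const ((α+2)*(α+3/2))
  refine Eq.mp (congrArg₂ (fun (f : ℕ → ℝ) (v : ℝ) => HasSum f v) (funext fun n => Eq.symm ?_)
    (Eq.symm ?_)) H
  · beta_reduce
    rw [cc_shift (s := 2*α+1) (by positivity), cc_shift hs]
    have e3 : 2*α+3 = 2*α+1+1+1 := by ring
    rw [e3, poch_shift (x := 2*α+1+1) (by positivity), poch_shift (x := 2*α+1) (by positivity)]
    have ea : 2*α/2 = α := by ring
    unfold cc
    rw [ea]
    have h3 := (poch_pos (x := 2*α+1) (by positivity) n).ne'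
    have h5 : (n.factorial : ℝ) ≠ 0 := by positivity
    have h6 : 2*α+1+n ≠ 0 := by positivity
    have h7 : 2*α+1+1+n ≠ 0 := by positivity
    have h8 : 2*α+n+1 ≠ 0 := by positivity
    have h9 : 2*α+1+n+1 ≠ 0 := by positivity
    have h10 : α+3/2 ≠ 0 := by positivity
    generalize poch α n = P1
    generalize poch (α+1/2) n = P2
    generalize poch (2*α+1) n = P3 at *
    generalize (n.factorial : ℝ) = P4 at *
    generalize z ^ n = P5
    generalize (n:ℝ) = m at *
    have e7 : 2*α+1+1+m = 2*α+m+2 := by ring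
    have e9 : 2*α+1+m+1 = 2*α+m+2 := by ring
    have e6 : 2*α+1+m = 2*α+m+1 := by ring
    rw [e7] at h7
    rw [e7, e9, e6]
    field_simp
    ring
  · obtain ⟨r0, r1, r2⟩ := sqrt_facts hz0 hz1
    have hg : (0:ℝ) < 1/2 + 1/2 * √(1-z) := by positivity
    have e1 : -(2*α+1) = -(2*α) - 1 := by ring
    have e2 : -(2*α+1+1) = -(2*α) - 1 - 1 := by ring
    rw [e1, e2, Real.rpow_sub_one hg.ne' (-(2*α) - 1), Real.rpow_sub_one hg.ne' (-(2*α))]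
    generalize (1/2 + 1/2 * √(1-z)) ^ (-(2*α)) = P
    generalize √(1-z) = r at *
    have hx' : z = 1 - r^2 := by linarith
    subst hx'
    have hf : (1 - r^2) = (1 - r) * (1 + r) := by ring
    have q1 : 1 - r ≠ 0 := by linarith
    have q2 : 1 + r ≠ 0 := by linarith
    have q3 : (1/2 + 1/2 * r) = (1 + r)/2 := by ring
    rw [q3, hf]
    have h10 : α+3/2 ≠ 0 := by positivity
    have h11 : α+1/2 ≠ 0 := by positivity
    have h12 : α+1 ≠ 0 := by positivity
    field_simp
    ring
end
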